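/- Let ω ⊂ ℝ^d be an open domain, d_* = d(d+1)/2 and k ≥ 2d_*. Given v ∈ C²(ω, ℝ^k), w ∈ C¹(ω, ℝ^d), functions a_i ∈ C²(ω, ℝ) and unit vectors η_i ∈ ℝ^d for i = 1…d_*, and a frequency λ > 0, define G(t) = sin t, Ḡ(t) = cos t, t_η = ⟨x, η⟩, and set ṽ(x) = v(x) + (1/λ)·Σ_{i=1}^{d_*} a_i(x)·(G(λt_{η_i})·e_i + Ḡ(λt_{η_i})·e_{d_*+i}) and w̃(x) = w(x) − (1/λ)·Σ_{i=1}^{d_*} a_i(x)·(G(λt_{η_i})·∇v^i(x) + Ḡ(λt_{η_i})·∇v^{d_*+i}(x)), where {e_j} is the standard basis of ℝ^k and v^j is the j-th component of v. Then (½(∇ṽ)ᵀ∇ṽ + sym∇w̃) − (½(∇v)ᵀ∇v + sym∇w) − ½·Σ_{i=1}^{d_*} a_i²·η_i⊗η_i = −(1/λ)·Σ_{i=1}^{d_*} a_i·(G(λt_{η_i})·∇²v^i + Ḡ(λt_{η_i})·∇²v^{d_*+i}) + (1/(2λ²))·Σ_{i=1}^{d_*} ∇a_i⊗∇a_i. 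-/

import Mathlib

noncomputable section
open Real
open scoped BigOperators

/-- Partial derivative of `f` in the `i`-th coordinate direction. -/
def pd {d : ℕ} {E : Type*} [NormedAddCommGroup E] [NormedSpace ℝ E]
    (i : Fin d) (f : (Fin d → ℝ) → E) (x : Fin d → ℝ) : E :=
  fderiv ℝ f x (Pi.single i 1)

/-- The matrix `(∇v)ᵀ∇v`, with entries `⟨∂ᵢv, ∂ⱼv⟩`. -/
def gradTgrad {d k : ℕ} (v : (Fin d → ℝ) → Fin k → ℝ) (x : Fin d → ℝ) :
    Fin d → Fin d → ℝ :=
  fun i j => ∑ l, pd i (fun y => v y l) x * pd j (fun y => v y l) x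

/-- The symmetrized gradient `sym∇w = ½(∇w + (∇w)ᵀ)`. -/
def symGrad {d : ℕ} (w : (Fin d → ℝ) → Fin d → ℝ) (x : Fin d → ℝ) :
    Fin d → Fin d → ℝ :=
  fun i j => (pd i (fun y => w y j) x + pd j (fun y => w y i) x) / 2

/-! ### Calculus of partial derivatives -/

section PartialDerivative

variable {d : ℕ} {f g : (Fin d → ℝ) → ℝ} {x : Fin d → ℝ} (p q : Fin d)

lemma pd_add (hf : DifferentiableAt ℝ f x) (hg : DifferentiableAt ℝ g x) :
    pd p (fun y => f y + g y) x = pd p f x + pd p g x := by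
  simp only [pd]
  rw [fderiv_fun_add hf hg]
  rfl

lemma pd_sub (hf : DifferentiableAt ℝ f x) (hg : DifferentiableAt ℝ g x) :
    pd p (fun y => f y - g y) x = pd p f x - pd p g x := by
  simp only [pd]
  rw [fderiv_fun_sub hf hg]
  rfl

lemma pd_mul (hf : DifferentiableAt ℝ f x) (hg : DifferentiableAt ℝ g x) :
    pd p (fun y => f y * g y) x = pd p f x * g x + f x * pd p g x := by
  simp only [pd]
  rw [fderiv_fun_mul hf hg]
  simp
  ring

lemma pd_const_mul (c : ℝ) (hf : DifferentiableAt ℝ f x) :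
    pd p (fun y => c * f y) x = c * pd p f x := by
  simp only [pd]
  rw [fderiv_const_mul hf c]
  rfl

lemma pd_mul_const (c : ℝ) (hf : DifferentiableAt ℝ f x) :
    pd p (fun y => f y * c) x = pd p f x * c := by
  simp only [mul_comm _ c]
  exact pd_const_mul p c hf

lemma pd_sum {ι : Type*} [Fintype ι] {F : ι → (Fin d → ℝ) → ℝ}
    (hF : ∀ i, DifferentiableAt ℝ (F i) x) :
    pd p (fun y => ∑ i, F i y) x = ∑ i, pd p (F i) x := by
  simp only [pd]
  rw [fderiv_fun_sum fun i _ => hF i]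
  simp

lemma pd_sin (hf : DifferentiableAt ℝ f x) :
    pd p (fun y => Real.sin (f y)) x = Real.cos (f x) * pd p f x := by
  simp only [pd]
  rw [fderiv_sin hf]
  rfl

lemma pd_cos (hf : DifferentiableAt ℝ f x) :
    pd p (fun y => Real.cos (f y)) x = -Real.sin (f x) * pd p f x := by
  simp only [pd]
  rw [fderiv_cos hf]
  rfl

lemma pd_phase (lam : ℝ) (η : Fin d → ℝ) (x : Fin d → ℝ) :
    pd p (fun y => lam * ∑ r, y r * η r) x = lam * η p := by
  rw [pd_const_mul p lam (by fun_prop), pd_sum p fun i => by fun_prop]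
  congr 1
  have h (r : Fin d) : pd p (fun y : Fin d → ℝ => y r * η r) x =
      (Pi.single p 1 : Fin d → ℝ) r * η r := by
    rw [pd_mul_const p (η r) (by fun_prop), pd, fderiv_apply differentiableAt_fun_id, fderiv_fun_id]
    rfl
  simp only [h, Pi.single_apply]
  simp

lemma pd_mul_sin_phase (lam : ℝ) (η : Fin d → ℝ) (hf : DifferentiableAt ℝ f x) :
    pd p (fun y => f y * Real.sin (lam * ∑ r, y r * η r)) x
      = pd p f x * Real.sin (lam * ∑ r, x r * η r)
        + lam * (f x * Real.cos (lam * ∑ r, x r * η r) * η p) := by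
  rw [pd_mul p hf (by fun_prop), pd_sin p (by fun_prop), pd_phase]
  ring

lemma pd_mul_cos_phase (lam : ℝ) (η : Fin d → ℝ) (hf : DifferentiableAt ℝ f x) :
    pd p (fun y => f y * Real.cos (lam * ∑ r, y r * η r)) x
      = pd p f x * Real.cos (lam * ∑ r, x r * η r)
        - lam * (f x * Real.sin (lam * ∑ r, x r * η r) * η p) := by
  rw [pd_mul p hf (by fun_prop), pd_cos p (by fun_prop), pd_phase]
  ring

lemma differentiableAt_pd (hf : ContDiffAt ℝ 2 f x) : DifferentiableAt ℝ (pd p f) x := by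
  have h : DifferentiableAt ℝ (fderiv ℝ f) x :=
    (hf.fderiv_right (m := 1) (by norm_num)).differentiableAt (by norm_num)
  exact h.clm_apply (differentiableAt_const _)

lemma pd_pd_comm (hf : ContDiffAt ℝ 2 f x) : pd p (pd q f) x = pd q (pd p f) x := by
  have h : DifferentiableAt ℝ (fderiv ℝ f) x :=
    (hf.fderiv_right (m := 1) (by norm_num)).differentiableAt (by norm_num)
  have key (r s : Fin d) : pd r (pd s f) x =
      fderiv ℝ (fderiv ℝ f) x (Pi.single r 1) (Pi.single s 1) := by
    change fderiv ℝ (fun y => fderiv ℝ f y (Pi.single s 1)) x (Pi.single r 1) = _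
    rw [fderiv_clm_apply h (differentiableAt_const _)]
    simp
  rw [key, key]
  exact hf.isSymmSndFDerivAt (by simp) _ _

end PartialDerivative

/-! ### Sums over two disjoint families of coordinates -/

lemma sum_mul_sum_single {k n : ℕ} (A : Fin k → ℝ) (s c : Fin n → ℝ) (I J : Fin n → Fin k) :
    ∑ l, A l * ∑ i, (s i * (Pi.single (I i) 1 : Fin k → ℝ) l
        + c i * (Pi.single (J i) 1 : Fin k → ℝ) l)
      = ∑ i, (s i * A (I i) + c i * A (J i)) := by
  simp only [Finset.mul_sum]
  rw [Finset.sum_comm]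
  refine Finset.sum_congr rfl fun i _ => ?_
  simp only [mul_add, Finset.sum_add_distrib, Pi.single_apply, mul_ite, mul_one, mul_zero,
    Finset.sum_ite_eq', Finset.mem_univ, if_true]
  ring

lemma sum_single_mul_sum_single {k n : ℕ} (s c s' c' : Fin n → ℝ) {I J : Fin n → Fin k}
    (hI : Function.Injective I) (hJ : Function.Injective J) (hIJ : ∀ i j, I i ≠ J j) :
    ∑ l, (∑ i, (s i * (Pi.single (I i) 1 : Fin k → ℝ) l
          + c i * (Pi.single (J i) 1 : Fin k → ℝ) l))
        * ∑ i, (s' i * (Pi.single (I i) 1 : Fin k → ℝ) l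
          + c' i * (Pi.single (J i) 1 : Fin k → ℝ) l)
      = ∑ i, (s i * s' i + c i * c' i) := by
  rw [sum_mul_sum_single]
  refine Finset.sum_congr rfl fun i _ => ?_
  simp only [Pi.single_apply, hI.eq_iff, hJ.eq_iff, hIJ, fun i j => (hIJ i j).symm]
  simp
  ring

/-- Corollary 2.4: superposition of `d_* = d(d+1)/2` spiral "steps" at a common
frequency `λ`, in codimension `k ≥ 2d_*`, using the standard basis vectors
`e_i, e_{d_*+i}` of `ℝ^k`. -/
theorem steps_spiral_superposition
    {d k dstar : ℕ} (hdstar : 2 * dstar = d * (d + 1)) (hk : 2 * dstar ≤ k)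
    (ω : Set (Fin d → ℝ)) (hω : IsOpen ω)
    (v : (Fin d → ℝ) → Fin k → ℝ) (w : (Fin d → ℝ) → Fin d → ℝ)
    (hv : ContDiffOn ℝ 2 v ω) (hw : ContDiffOn ℝ 1 w ω)
    (a : Fin dstar → (Fin d → ℝ) → ℝ) (ha : ∀ i, ContDiffOn ℝ 2 (a i) ω)
    (η : Fin dstar → Fin d → ℝ) (hη : ∀ i, ∑ p, η i p ^ 2 = 1)
    (lam : ℝ) (hlam : 0 < lam)
    (vt : (Fin d → ℝ) → Fin k → ℝ) (wt : (Fin d → ℝ) → Fin d → ℝ)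
    (hvt : vt = fun x l => v x l
      + (1 / lam) * ∑ i : Fin dstar, a i x
          * (Real.sin (lam * ∑ p, x p * η i p)
              * (Pi.single (⟨i.1, by omega⟩ : Fin k) 1 : Fin k → ℝ) l
            + Real.cos (lam * ∑ p, x p * η i p)
              * (Pi.single (⟨dstar + i.1, by omega⟩ : Fin k) 1 : Fin k → ℝ) l))
    (hwt : wt = fun x j => w x j
      - (1 / lam) * ∑ i : Fin dstar, a i x
          * (Real.sin (lam * ∑ p, x p * η i p)
              * pd j (fun y => v y (⟨i.1, by omega⟩ : Fin k)) x
            + Real.cos (lam * ∑ p, x p * η i p)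
              * pd j (fun y => v y (⟨dstar + i.1, by omega⟩ : Fin k)) x)) :
    ∀ x ∈ ω, ∀ p q : Fin d,
      ((1/2) * gradTgrad vt x p q + symGrad wt x p q)
        - ((1/2) * gradTgrad v x p q + symGrad w x p q)
        - (1/2) * ∑ i : Fin dstar, a i x ^ 2 * η i p * η i q
      = -(1 / lam) * ∑ i : Fin dstar, a i x
            * (Real.sin (lam * ∑ p', x p' * η i p')
                * pd p (fun y => pd q (fun z => v z (⟨i.1, by omega⟩ : Fin k)) y) x
              + Real.cos (lam * ∑ p', x p' * η i p')
                * pd p (fun y => pd q (fun z => v z (⟨dstar + i.1, by omega⟩ : Fin k)) y) x)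
        + (1 / (2 * lam ^ 2)) * ∑ i : Fin dstar, pd p (a i) x * pd q (a i) x := by
  intro x hx p q
  have hxω : ω ∈ nhds x := hω.mem_nhds hx
  have hv2 (l : Fin k) : ContDiffAt ℝ 2 (fun y => v y l) x :=
    contDiffAt_pi.1 (hv.contDiffAt hxω) l
  have hvd (l : Fin k) : DifferentiableAt ℝ (fun y => v y l) x :=
    (hv2 l).differentiableAt (by norm_num)
  have hwd (j : Fin d) : DifferentiableAt ℝ (fun y => w y j) x :=
    (contDiffAt_pi.1 (hw.contDiffAt hxω) j).differentiableAt (by norm_num)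
  have had (i : Fin dstar) : DifferentiableAt ℝ (a i) x :=
    ((ha i).contDiffAt hxω).differentiableAt (by norm_num)
  have hpd (l : Fin k) (r : Fin d) : DifferentiableAt ℝ (pd r fun y => v y l) x :=
    differentiableAt_pd r (hv2 l)
  set I : Fin dstar → Fin k := fun i => ⟨i.1, by omega⟩ with hIdef
  set J : Fin dstar → Fin k := fun i => ⟨dstar + i.1, by omega⟩ with hJdef
  have hI : Function.Injective I := fun i j h => by
    simpa [hIdef, Fin.ext_iff] using h
  have hJ : Function.Injective J := fun i j h => by
    simpa [hJdef, Fin.ext_iff] using h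
  have hIJ (i j : Fin dstar) : I i ≠ J j := fun h => by
    simp only [hIdef, hJdef, Fin.mk.injEq] at h
    omega
  let S (i : Fin dstar) (y : Fin d → ℝ) : ℝ := a i y * Real.sin (lam * ∑ r, y r * η i r)
  let C (i : Fin dstar) (y : Fin d → ℝ) : ℝ := a i y * Real.cos (lam * ∑ r, y r * η i r)
  have hS (i : Fin dstar) : DifferentiableAt ℝ (S i) x := by
    have := had i
    fun_prop
  have hC (i : Fin dstar) : DifferentiableAt ℝ (C i) x := by
    have := had i
    fun_prop
  have hvt' (l : Fin k) : (fun y => vt y l) = fun y => v y l + (1 / lam) *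
      ∑ i, (S i y * (Pi.single (I i) 1 : Fin k → ℝ) l
        + C i y * (Pi.single (J i) 1 : Fin k → ℝ) l) := by
    subst hvt
    simp only [S, C, I, J, mul_add, mul_assoc]
  have hwt' (j : Fin d) : (fun y => wt y j) = fun y => w y j - (1 / lam) *
      ∑ i, (S i y * pd j (fun z => v z (I i)) y + C i y * pd j (fun z => v z (J i)) y) := by
    subst hwt
    simp only [S, C, I, J, mul_add, mul_assoc]
  have pd_vt (r : Fin d) (l : Fin k) : pd r (fun y => vt y l) x = pd r (fun y => v y l) x
      + (1 / lam) * ∑ i, (pd r (S i) x * (Pi.single (I i) 1 : Fin k → ℝ) l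
        + pd r (C i) x * (Pi.single (J i) 1 : Fin k → ℝ) l) := by
    rw [hvt', pd_add r (hvd l) (by fun_prop), pd_const_mul r _ (by fun_prop),
      pd_sum r fun i => by fun_prop]
    congr 2
    refine Finset.sum_congr rfl fun i _ => ?_
    rw [pd_add r (by fun_prop) (by fun_prop), pd_mul_const r _ (hS i), pd_mul_const r _ (hC i)]
  have pd_wt (r j : Fin d) : pd r (fun y => wt y j) x = pd r (fun y => w y j) x
      - (1 / lam) * ∑ i, (pd r (S i) x * pd j (fun z => v z (I i)) x
        + S i x * pd r (pd j fun z => v z (I i)) x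
        + (pd r (C i) x * pd j (fun z => v z (J i)) x
        + C i x * pd r (pd j fun z => v z (J i)) x)) := by
    have h1 (i : Fin dstar) :
        DifferentiableAt ℝ (fun y => S i y * pd j (fun z => v z (I i)) y) x :=
      (hS i).fun_mul (hpd (I i) j)
    have h2 (i : Fin dstar) :
        DifferentiableAt ℝ (fun y => C i y * pd j (fun z => v z (J i)) y) x :=
      (hC i).fun_mul (hpd (J i) j)
    rw [hwt', pd_sub r (hwd j) (by fun_prop), pd_const_mul r _ (by fun_prop),
      pd_sum r fun i => (h1 i).fun_add (h2 i)]
    congr 2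
    refine Finset.sum_congr rfl fun i _ => ?_
    rw [pd_add r (h1 i) (h2 i), pd_mul r (hS i) (hpd _ j), pd_mul r (hC i) (hpd _ j)]
  have grad_vt : gradTgrad vt x p q = gradTgrad v x p q
      + (1 / lam) * ∑ i, (pd q (S i) x * pd p (fun y => v y (I i)) x
        + pd q (C i) x * pd p (fun y => v y (J i)) x)
      + (1 / lam) * ∑ i, (pd p (S i) x * pd q (fun y => v y (I i)) x
        + pd p (C i) x * pd q (fun y => v y (J i)) x)
      + (1 / lam) ^ 2 * ∑ i, (pd p (S i) x * pd q (S i) x + pd p (C i) x * pd q (C i) x) := by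
    rw [← sum_mul_sum_single (fun l => pd p (fun y => v y l) x),
      ← sum_mul_sum_single (fun l => pd q (fun y => v y l) x),
      ← sum_single_mul_sum_single _ _ _ _ hI hJ hIJ]
    simp only [gradTgrad, pd_vt]
    rw [Finset.mul_sum, Finset.mul_sum, Finset.mul_sum, ← Finset.sum_add_distrib,
      ← Finset.sum_add_distrib, ← Finset.sum_add_distrib]
    refine Finset.sum_congr rfl fun l _ => ?_
    ring
  have quadratic : ∑ i, (pd p (S i) x * pd q (S i) x + pd p (C i) x * pd q (C i) x)
      = ∑ i, pd p (a i) x * pd q (a i) x + lam ^ 2 * ∑ i, a i x ^ 2 * η i p * η i q := by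
    rw [Finset.mul_sum, ← Finset.sum_add_distrib]
    refine Finset.sum_congr rfl fun i _ => ?_
    simp only [S, C]
    simp only [pd_mul_sin_phase _ lam (η i) (had i), pd_mul_cos_phase _ lam (η i) (had i)]
    linear_combination (pd p (a i) x * pd q (a i) x + lam ^ 2 * (a i x ^ 2 * η i p * η i q)) *
      Real.sin_sq_add_cos_sq (lam * ∑ r, x r * η i r)
  have hessian : ∑ i, a i x * (Real.sin (lam * ∑ r, x r * η i r)
        * pd p (pd q fun z => v z (I i)) x
      + Real.cos (lam * ∑ r, x r * η i r) * pd p (pd q fun z => v z (J i)) x)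
      = ∑ i, S i x * pd p (pd q fun z => v z (I i)) x
        + ∑ i, C i x * pd p (pd q fun z => v z (J i)) x := by
    simp only [S, C, mul_add, mul_assoc, Finset.sum_add_distrib]
  change _ = -(1 / lam) * (∑ i, a i x * (Real.sin (lam * ∑ r, x r * η i r)
        * pd p (pd q fun z => v z (I i)) x
      + Real.cos (lam * ∑ r, x r * η i r) * pd p (pd q fun z => v z (J i)) x)) + _
  rw [hessian, grad_vt, quadratic]
  simp only [symGrad, pd_wt, pd_pd_comm q p (hv2 _), Finset.sum_add_distrib]
  field_simp
  ring
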